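/- The Σ-induced multi-rb culpability measure m^Σ_{C_D} induced by the drastic culpability measure C_D satisfies Multiset Free Formula Independence (IN): for every multiset of rule bases M and every rule r, if r is a free formula of M ∪ {r} then V̂^{m^Σ_{C_D}}(M ∪ {r}) = V̂^{m^Σ_{C_D}}(M). -/

import Mathlib

open scoped Classical

/-- A literal over a set of atoms `A`: an atom or its negation. -/
inductive Literal (A : Type) where
  | pos (a : A)
  | neg (a : A)
deriving DecidableEq

/-- A business rule `l₁,...,lₘ → l₀`: a finite body of literals and a head literal.
A rule with empty body is a fact. -/
structure Rule (A : Type) where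
  body : Finset (Literal A)
  head : Literal A

instance {A : Type} [DecidableEq A] : DecidableEq (Rule A) :=
  fun r s => decidable_of_iff (r.body = s.body ∧ r.head = s.head)
    (by cases r; cases s; simp)

/-- A set of literals `M` is closed w.r.t. a rule base `B` if for every rule of `B`
whose body is contained in `M`, its head is in `M`. -/
def LitsClosed {A : Type} (B : Finset (Rule A)) (M : Set (Literal A)) : Prop :=
  ∀ r ∈ B, (∀ l ∈ r.body, l ∈ M) → r.head ∈ M

/-- The minimal model of a rule base: the smallest closed set of literals. -/
def minModel {A : Type} (B : Finset (Rule A)) : Set (Literal A) :=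
  ⋂₀ {M : Set (Literal A) | LitsClosed B M}

/-- A set of literals is consistent if it contains no atom together with its negation. -/
def ConsistentLits {A : Type} (M : Set (Literal A)) : Prop :=
  ∀ a : A, ¬ (Literal.pos a ∈ M ∧ Literal.neg a ∈ M)

/-- A rule base is consistent if its minimal model is consistent. -/
def RBConsistent {A : Type} (B : Finset (Rule A)) : Prop :=
  ConsistentLits (minModel B)

/-- `MI B`: the minimal inconsistent subsets of `B`. -/
noncomputable def MI {A : Type} [DecidableEq A] (B : Finset (Rule A)) :
    Finset (Finset (Rule A)) :=
  B.powerset.filter fun M => ¬ RBConsistent M ∧ ∀ M' ∈ M.powerset, M' ≠ M → RBConsistent M'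

/-- `F(B)`: the facts (rules with empty body) of a rule base. -/
noncomputable def factsOf {A : Type} (B : Finset (Rule A)) : Finset (Rule A) :=
  B.filter fun r => r.body = ∅

/-- `R(B)`: the non-fact rules of a rule base. -/
noncomputable def rulesOf {A : Type} (B : Finset (Rule A)) : Finset (Rule A) :=
  B.filter fun r => r.body ≠ ∅

/-- The Σ-induced multi-rb culpability measure: a multiset of rule bases is given by a shared
rule set `R` and case-dependent fact sets `F i`, so that `Bᵢ = F i ∪ R`;
then `m^Σ_C(M, r) = Σᵢ C(Bᵢ, r)`. -/
noncomputable def mSigma {A : Type} [DecidableEq A] {n : ℕ}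
    (C : Finset (Rule A) → Rule A → ENNReal)
    (R : Finset (Rule A)) (F : Fin n → Finset (Rule A)) (r : Rule A) : ENNReal :=
  ∑ i : Fin n, C (F i ∪ R) r

/-- `V̂^{C^m}(M) = max_{r ∈ R(M)} C^m(M, r)` for the Σ-induced measure. -/
noncomputable def Vhat {A : Type} [DecidableEq A] {n : ℕ}
    (C : Finset (Rule A) → Rule A → ENNReal)
    (R : Finset (Rule A)) (F : Fin n → Finset (Rule A)) : ENNReal :=
  R.sup fun r => mSigma C R F r

/-- The drastic culpability measure `C_D`. -/
noncomputable def CD {A : Type} [DecidableEq A] (B : Finset (Rule A)) (r : Rule A) : ENNReal :=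
  if ∃ M ∈ MI B, r ∈ M then 1 else 0

theorem mem_MI_iff {A : Type} [DecidableEq A] {B M : Finset (Rule A)} :
    M ∈ MI B ↔ M ⊆ B ∧ ¬ RBConsistent M ∧ ∀ M' ⊆ M, M' ≠ M → RBConsistent M' := by
  simp [MI]

/-- Adding a free formula does not change the minimal inconsistent subsets. -/
theorem MI_insert_of_free {A : Type} [DecidableEq A] {B : Finset (Rule A)} {r : Rule A}
    (hfree : ∀ M ∈ MI (insert r B), r ∉ M) : MI (insert r B) = MI B := by
  ext M
  constructor
  · intro hM
    obtain ⟨hsub, hmin⟩ := mem_MI_iff.1 hM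
    exact mem_MI_iff.2 ⟨(Finset.subset_insert_iff_of_notMem (hfree M hM)).1 hsub, hmin⟩
  · intro hM
    obtain ⟨hsub, hmin⟩ := mem_MI_iff.1 hM
    exact mem_MI_iff.2 ⟨hsub.trans (Finset.subset_insert r B), hmin⟩

/-- `m^Σ_{C_D}` satisfies Multiset Free Formula Independence (IN). -/
theorem mSigma_CD_multiset_free_formula_independence {A : Type} [DecidableEq A] (n : ℕ)
    (R : Finset (Rule A)) (F : Fin n → Finset (Rule A))
    (hR : ∀ x ∈ R, x.body ≠ ∅) (hF : ∀ i : Fin n, ∀ x ∈ F i, Rule.body x = ∅)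
    (r : Rule A) (hr : r.body ≠ ∅)
    (hfree : ∀ i : Fin n, ∀ M ∈ MI (F i ∪ insert r R), r ∉ M) :
    Vhat CD (insert r R) F = Vhat CD R F := by
  simp only [Finset.union_insert] at hfree
  have hC : ∀ x, mSigma CD (insert r R) F x = mSigma CD R F x := by
    intro x
    simp only [mSigma, CD, Finset.union_insert, MI_insert_of_free (hfree _)]
  have h0 : mSigma CD R F r = 0 := by
    simp only [MI_insert_of_free (hfree _)] at hfree
    refine Finset.sum_eq_zero fun i _ => if_neg ?_
    rintro ⟨M, hM, hrM⟩
    exact hfree i M hM hrM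
  simp only [Vhat, hC, Finset.sup_insert, h0]
  exact bot_sup_eq _
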